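/- arXiv:1702.03645 — 2 statements merged into one kernel-verified Lean document; each statement's English description precedes it below -/
import Mathlib

section
/- Let R be a commutative noetherian local ring, let X and N be finitely generated R-modules with N nonzero, and let n ≥ 1 be an integer. If Ext^i_R(X,N) = 0 for all 1 ≤ i ≤ n−1, then depth_R(Hom_R(X,N)) ≥ min{n+1, depth_R(N)}. -/
open CategoryTheory

universe u

/-- The `i`-th Ext module `Ext_R^i(M, N)` of `R`-modules `M` and `N`. -/
noncomputable def extModule (R : Type u) [CommRing R] (M N : Type u)
    [AddCommGroup M] [Module R M] [AddCommGroup N] [Module R N] (i : ℕ) : ModuleCat.{u} R :=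
  ((Ext R (ModuleCat.{u} R) i).obj (Opposite.op (ModuleCat.of R M))).obj (ModuleCat.of R N)

/-- The `i`-th Tor module `Tor^R_i(M, N)` of `R`-modules `M` and `N`. -/
noncomputable def torModule (R : Type u) [CommRing R] (M N : Type u)
    [AddCommGroup M] [Module R M] [AddCommGroup N] [Module R N] (i : ℕ) : ModuleCat.{u} R :=
  ((Tor (ModuleCat.{u} R) i).obj (ModuleCat.of R M)).obj (ModuleCat.of R N)

/-- The depth of a module `M` over a local ring `R`:
`inf { i | Ext^i_R(k, M) ≠ 0 }` where `k` is the residue field, an element of `ℕ∞`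
(the zero module has depth `⊤`, since the infimum of the empty set in `ℕ∞` is `⊤`). -/
noncomputable def moduleDepth (R : Type u) [CommRing R] [IsLocalRing R] (M : Type u)
    [AddCommGroup M] [Module R M] : ℕ∞ :=
  sInf {i : ℕ∞ | ∃ n : ℕ, i = (n : ℕ∞) ∧
    Nontrivial (extModule R (IsLocalRing.ResidueField R) M n)}

/-- A module `M` is totally reflexive if the canonical evaluation map `M → M**` is bijective
and `Ext^i_R(M, R) = 0 = Ext^i_R(M*, R)` for all `i > 0`. -/
def IsTotallyReflexive (R : Type u) [CommRing R] (M : Type u)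
    [AddCommGroup M] [Module R M] : Prop :=
  Function.Bijective (Module.Dual.eval R M) ∧
    (∀ i : ℕ, 0 < i → Subsingleton (extModule R M R i)) ∧
    (∀ i : ℕ, 0 < i → Subsingleton (extModule R (Module.Dual R M) R i))

/-- A module `P` has finite projective dimension iff for some `n`, `Ext^i_R(P, -)` vanishes
for all `i > n`. -/
def HasFiniteProjectiveDimension (R : Type u) [CommRing R] (P : Type u)
    [AddCommGroup P] [Module R P] : Prop :=
  ∃ n : ℕ, ∀ (N : Type u) [AddCommGroup N] [Module R N] (i : ℕ), n < i →
    Subsingleton (extModule R P N i)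

/-- A module `Q` has finite injective dimension iff for some `n`, `Ext^i_R(-, Q)` vanishes
for all `i > n`. -/
def HasFiniteInjectiveDimension (R : Type u) [CommRing R] (Q : Type u)
    [AddCommGroup Q] [Module R Q] : Prop :=
  ∃ n : ℕ, ∀ (N : Type u) [AddCommGroup N] [Module R N] (i : ℕ), n < i →
    Subsingleton (extModule R N Q i)

section

variable {R : Type u} [CommRing R]

/-- The classical `Ext` module vanishes in degree `i` iff every `i`-cocycle of the complex
`Hom(P, N)` is the image of the differential. -/
lemma CategoryTheory.ProjectiveResolution.subsingleton_extObj_iff {M : ModuleCat.{u} R}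
    (P : ProjectiveResolution M) (N : ModuleCat.{u} R) (i j : ℕ)
    (hj : (ComplexShape.up ℕ).prev i = j) :
    Subsingleton (((Ext R (ModuleCat.{u} R) i).obj (Opposite.op M)).obj N) ↔
      ∀ f : P.complex.X i ⟶ N, P.complex.d (i + 1) i ≫ f = 0 →
        ∃ g : P.complex.X j ⟶ N, P.complex.d i j ≫ g = f := by
  rw [← ModuleCat.isZero_iff_subsingleton, (P.isoExt i N).isZero_iff,
    ← HomologicalComplex.exactAt_iff_isZero_homology,
    HomologicalComplex.exactAt_iff' _ j i (i + 1) hj (by simp),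
    ShortComplex.moduleCat_exact_iff]
  rfl

/-- The derived-category `Ext` group and the classical `Ext` module vanish simultaneously. -/
lemma subsingleton_extObj_iff_subsingleton_ext (M N : ModuleCat.{u} R) (i : ℕ) :
    Subsingleton (((Ext R (ModuleCat.{u} R) i).obj (Opposite.op M)).obj N) ↔
      Subsingleton (Abelian.Ext M N i) := by
  let P := projectiveResolution M
  cases i with
  | zero =>
    rw [P.subsingleton_extObj_iff N 0 0 (by simp), Abelian.Ext.addEquiv₀.subsingleton_congr]
    have hd : P.complex.d 0 0 = 0 := P.complex.shape _ _ (by simp)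
    simp only [hd, Limits.zero_comp, exists_const]
    constructor
    · intro h
      refine subsingleton_of_forall_eq 0 fun f ↦ ?_
      let q : P.complex.X 0 ⟶ M := P.π.f 0
      have : Epi q := inferInstanceAs (Epi (P.π.f 0))
      have hq : P.complex.d 1 0 ≫ q = 0 := P.complex_d_comp_π_f_zero
      rw [← cancel_epi q, Limits.comp_zero]
      exact (h (q ≫ f) (by rw [zero_add, reassoc_of% hq, Limits.zero_comp])).symm
    · intro h f hf
      have hd₀ := P.exact₀
      rw [← hd₀.g_desc f hf]
      have hg : hd₀.desc f hf = 0 := h.elim _ _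
      rw [hg, Limits.comp_zero]
  | succ p =>
    rw [P.subsingleton_extObj_iff N (p + 1) p (by simp)]
    constructor
    · intro h
      refine subsingleton_of_forall_eq 0 fun x ↦ ?_
      obtain ⟨f, hf, rfl⟩ := P.extMk_surjective x (p + 2) rfl
      exact (P.extMk_eq_zero_iff f _ rfl hf p rfl).2 (h f hf)
    · intro h f hf
      exact (P.extMk_eq_zero_iff f (p + 2) rfl hf p rfl).1 (h.elim _ _)

lemma subsingleton_extModule_iff (M N : Type u) [AddCommGroup M] [Module R M]
    [AddCommGroup N] [Module R N] (i : ℕ) :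
    Subsingleton (extModule R M N i) ↔
      Subsingleton (Abelian.Ext (ModuleCat.of R M) (ModuleCat.of R N) i) :=
  subsingleton_extObj_iff_subsingleton_ext _ _ i

lemma natCast_le_moduleDepth_iff [IsLocalRing R] (M : Type u) [AddCommGroup M] [Module R M]
    (d : ℕ) : (d : ℕ∞) ≤ moduleDepth R M ↔
      ∀ i < d, Subsingleton (extModule R (IsLocalRing.ResidueField R) M i) := by
  simp only [moduleDepth, le_sInf_iff, Set.mem_ofPred_eq, forall_exists_index, and_imp]
  constructor
  · intro h i hi
    by_contra hn
    have := h i i rfl (not_subsingleton_iff_nontrivial.1 hn)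
    exact absurd (Nat.cast_le.1 this) (by omega)
  · rintro h _ i rfl hn
    by_contra hi
    exact not_subsingleton_iff_nontrivial.2 hn (h i (by simpa using hi))

lemma CategoryTheory.Abelian.Ext.subsingleton_of_iso {L M N : ModuleCat.{u} R} {i : ℕ}
    (e : M ≅ N) [Subsingleton (Abelian.Ext L N i)] : Subsingleton (Abelian.Ext L M i) := by
  refine subsingleton_of_forall_eq 0 fun x ↦ ?_
  have hx : (x.comp (Abelian.Ext.mk₀ e.hom) (add_zero i)).comp
      (Abelian.Ext.mk₀ e.inv) (add_zero i) = x := by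
    simp
  rw [← hx, Subsingleton.elim (x.comp (Abelian.Ext.mk₀ e.hom) (add_zero i)) 0,
    Abelian.Ext.zero_comp]

lemma CategoryTheory.Abelian.Ext.subsingleton_pi (L : ModuleCat.{u} R) {ι : Type} [Fintype ι]
    [DecidableEq ι] (N : Type u) [AddCommGroup N] [Module R N] {i : ℕ}
    [Subsingleton (Abelian.Ext L (ModuleCat.of R N) i)] :
    Subsingleton (Abelian.Ext L (ModuleCat.of R (ι → N)) i) := by
  refine subsingleton_of_forall_eq 0 fun x ↦ ?_
  let p (a : ι) : ModuleCat.of R (ι → N) ⟶ ModuleCat.of R N := ModuleCat.ofHom (LinearMap.proj a)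
  let s (a : ι) : ModuleCat.of R N ⟶ ModuleCat.of R (ι → N) :=
    ModuleCat.ofHom (LinearMap.single R (fun _ ↦ N) a)
  have hsum : ∑ a, p a ≫ s a = 𝟙 _ := by
    ext1
    rw [ModuleCat.hom_sum]
    refine LinearMap.ext fun v ↦ ?_
    simp only [LinearMap.sum_apply, p, s]
    exact Finset.univ_sum_single v
  rw [← x.comp_mk₀_id, ← hsum, Abelian.Ext.mk₀_sum, Abelian.Ext.comp_sum]
  refine Finset.sum_eq_zero fun a _ ↦ ?_
  rw [← Abelian.Ext.mk₀_comp_mk₀, ← Abelian.Ext.comp_assoc_of_second_deg_zero,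
    Subsingleton.elim (x.comp (Abelian.Ext.mk₀ (p a)) (add_zero i)) 0, Abelian.Ext.zero_comp]

/-- If `Ext^i(X, N) = 0` for `0 < i < j` and `Ext^i(L, N) = 0` for `i ≤ j`, then
`Ext^j(L, Hom(X, N)) = 0`. -/
theorem subsingleton_ext_linearMap [IsNoetherianRing R] (L : ModuleCat.{u} R)
    (N : Type u) [AddCommGroup N] [Module R N] (j : ℕ)
    (X : Type u) [AddCommGroup X] [Module R X] [Module.Finite R X]
    (hX : ∀ i, 0 < i → i < j →
      Subsingleton (Abelian.Ext (ModuleCat.of R X) (ModuleCat.of R N) i))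
    (hL : ∀ i ≤ j, Subsingleton (Abelian.Ext L (ModuleCat.of R N) i)) :
    Subsingleton (Abelian.Ext L (ModuleCat.of R (X →ₗ[R] N)) j) := by
  induction j generalizing X with
  | zero =>
    have := (Abelian.Ext.addEquiv₀.trans ModuleCat.homAddEquiv).symm.subsingleton_congr.2
      (hL 0 le_rfl)
    rw [(Abelian.Ext.addEquiv₀.trans ModuleCat.homAddEquiv).subsingleton_congr]
    refine subsingleton_of_forall_eq 0 fun f ↦ LinearMap.ext fun a ↦ LinearMap.ext fun x ↦ ?_
    exact LinearMap.congr_fun (Subsingleton.elim (f.flip x) 0) a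
  | succ j ih =>
    obtain ⟨m, π, hπ⟩ := Module.Finite.exists_fin' R X
    have hS := LinearMap.shortExact_shortComplexKer hπ
    have hF : Subsingleton (Abelian.Ext L (ModuleCat.of R ((Fin m → R) →ₗ[R] N)) (j + 1)) := by
      have := hL (j + 1) le_rfl
      have := Abelian.Ext.subsingleton_pi L (ι := Fin m) N (i := j + 1)
      exact Abelian.Ext.subsingleton_of_iso
        (LinearEquiv.piRing R N (Fin m) R).toModuleIso
    let res : ((Fin m → R) →ₗ[R] N) →ₗ[R] (LinearMap.ker π →ₗ[R] N) :=
      LinearMap.lcomp R N (LinearMap.ker π).subtype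
    have hC : Subsingleton (Abelian.Ext L (ModuleCat.of R (LinearMap.range res)) j) := by
      cases j with
      | zero =>
        have := ih (LinearMap.ker π) (by omega) (fun i hi ↦ hL i (by omega))
        have : Mono (ModuleCat.ofHom (LinearMap.range res).subtype) :=
          (ModuleCat.mono_iff_injective _).2 Subtype.val_injective
        exact (Abelian.Ext.postcomp_mk₀_injective_of_mono L
          (ModuleCat.ofHom (LinearMap.range res).subtype)).subsingleton
      | succ j =>
        have hK := ih (LinearMap.ker π) (fun i hi hij ↦ by
          have := hX (i + 1) (by omega) (by omega)
          refine subsingleton_of_forall_eq 0 fun x ↦ ?_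
          obtain ⟨y, rfl⟩ := Abelian.Ext.contravariant_sequence_exact₁ hS (ModuleCat.of R N) x
            (add_comm 1 i) (Subsingleton.elim _ _)
          obtain ⟨i, rfl⟩ : ∃ i', i = i' + 1 := ⟨i - 1, by omega⟩
          rw [Abelian.Ext.eq_zero_of_projective y, Abelian.Ext.comp_zero])
          (fun i hi ↦ hL i (by omega))
        have htop : LinearMap.range res = ⊤ := by
          rw [LinearMap.range_eq_top]
          intro φ
          have := hX 1 (by omega) (by omega)
          obtain ⟨y, hy⟩ := Abelian.Ext.contravariant_sequence_exact₁ hS (ModuleCat.of R N)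
            (Abelian.Ext.mk₀ (ModuleCat.ofHom φ)) (add_zero 1) (Subsingleton.elim _ _)
          obtain ⟨ψ, rfl⟩ := Abelian.Ext.mk₀_bijective _ _ |>.2 y
          rw [Abelian.Ext.mk₀_comp_mk₀] at hy
          have := (Abelian.Ext.mk₀_bijective _ _).1 hy
          exact ⟨ψ.hom, congrArg ModuleCat.Hom.hom this⟩
        exact Abelian.Ext.subsingleton_of_iso (LinearEquiv.ofTop _ htop).toModuleIso
    let S : ShortComplex (ModuleCat.{u} R) :=
      ShortComplex.mk (ModuleCat.ofHom (LinearMap.lcomp R N π)) (ModuleCat.ofHom res.rangeRestrict)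
        (by
          ext f x
          exact (congrArg f x.2).trans (map_zero f))
    have hT : S.ShortExact := by
      refine ModuleCat.shortComplex_shortExact S ?_ ?_ ?_
      · intro f
        have hex := LinearMap.exact_lcomp_of_exact_of_surjective N π.exact_subtype_ker_map hπ
        exact Subtype.ext_iff.trans (hex f)
      · intro f g hfg
        exact (LinearMap.cancel_right hπ).1 hfg
      · exact res.surjective_rangeRestrict
    refine subsingleton_of_forall_eq 0 fun x ↦ ?_
    obtain ⟨y, rfl⟩ := Abelian.Ext.covariant_sequence_exact₁ L hT x (hF.elim _ _) rfl
    rw [hC.elim y 0, Abelian.Ext.zero_comp]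

end

/-- Let `R` be a noetherian local ring, `X` and `N` finitely generated `R`-modules with `N`
nonzero, and `n ≥ 1`.  If `Ext^i_R(X, N) = 0` for all `1 ≤ i ≤ n - 1`, then
`depth Hom_R(X, N) ≥ min (n + 1) (depth N)`. -/
theorem depth_hom_ge
    (R : Type u) [CommRing R] [IsNoetherianRing R] [IsLocalRing R]
    (X N : Type u) [AddCommGroup X] [Module R X] [Module.Finite R X]
    [AddCommGroup N] [Module R N] [Module.Finite R N] [Nontrivial N]
    (n : ℕ) (hn : 1 ≤ n)
    (hExt : ∀ i : ℕ, 1 ≤ i → i ≤ n - 1 → Subsingleton (extModule R X N i)) :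
    min ((n : ℕ∞) + 1) (moduleDepth R N) ≤ moduleDepth R (X →ₗ[R] N) := by
  refine ENat.forall_natCast_le_iff_le.1 fun d hd ↦ ?_
  obtain ⟨hdn, hdN⟩ := le_min_iff.1 hd
  rw [natCast_le_moduleDepth_iff] at hdN ⊢
  have hdn : d ≤ n + 1 := by exact_mod_cast hdn
  intro j hj
  rw [subsingleton_extModule_iff]
  exact subsingleton_ext_linearMap _ N j X
    (fun i hi hij ↦ (subsingleton_extModule_iff X N i).1 (hExt i hi (by omega)))
    (fun i hi ↦ (subsingleton_extModule_iff _ N i).1 (hdN i (by omega)))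
end

section
/- Let k be a field and let R = k[[x,y]]/(xy). Then Ext^1_R(R/(x), R/(x²)) = 0. -/
open CategoryTheory

universe u

/-- The Huneke-Wiegand ring `R = k[[x,y]]/(xy)`. -/
abbrev HWRing (k : Type u) [Field k] : Type u :=
  MvPowerSeries (Fin 2) k ⧸
    Ideal.span {(MvPowerSeries.X 0 * MvPowerSeries.X 1 : MvPowerSeries (Fin 2) k)}

/-- The image of `x` in `R = k[[x,y]]/(xy)`. -/
noncomputable def HWx (k : Type u) [Field k] : HWRing k :=
  Ideal.Quotient.mk _ (MvPowerSeries.X 0)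

/-- The module `M = R/(x)` over `R = k[[x,y]]/(xy)`. -/
abbrev HWM (k : Type u) [Field k] : Type u :=
  HWRing k ⧸ Ideal.span {HWx k}

/-- The module `N = R/(x²)` over `R = k[[x,y]]/(xy)`. -/
abbrev HWN (k : Type u) [Field k] : Type u :=
  HWRing k ⧸ Ideal.span {HWx k ^ 2}

/-- If `y * x = 0` and every element of `N` killed by `y` is a multiple of `x`, then linear maps into
`N` extend from the kernel of a surjection `P → R/(x)` to the projective module `P`. -/
theorem exists_comp_ker_subtype_eq {R P N : Type*} [CommRing R] [AddCommGroup P] [Module R P]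
    [AddCommGroup N] [Module R N] [Module.Projective R P] {x y : R} (hyx : y * x = 0)
    (hN : ∀ n : N, y • n = 0 → ∃ m, n = x • m) (π : P →ₗ[R] R ⧸ Ideal.span {x})
    (hπ : Function.Surjective π) (φ : LinearMap.ker π →ₗ[R] N) :
    ∃ g : P →ₗ[R] N, g ∘ₗ (LinearMap.ker π).subtype = φ := by
  obtain ⟨h, hh⟩ := Module.projective_lifting_property (Submodule.mkQ (Ideal.span {x})) π
    (Submodule.mkQ_surjective _)
  obtain ⟨e, he⟩ := hπ (Submodule.mkQ (Ideal.span {x}) 1)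
  have hπh (p : P) : π p = Submodule.mkQ (Ideal.span {x}) (h p) :=
    (LinearMap.congr_fun hh p).symm
  have hker (p : P) : p - h p • e ∈ LinearMap.ker π := by
    rw [LinearMap.mem_ker, map_sub, map_smul, he, hπh, ← map_smul, smul_eq_mul, mul_one, sub_self]
  have hxe : x • e ∈ LinearMap.ker π := by
    rw [LinearMap.mem_ker, map_smul, he, ← map_smul, smul_eq_mul, mul_one, Submodule.mkQ_apply,
      Submodule.Quotient.mk_eq_zero]
    exact Ideal.mem_span_singleton_self x
  obtain ⟨n, hn⟩ := hN (φ ⟨x • e, hxe⟩) <| by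
    rw [← map_smul]
    convert map_zero φ
    ext
    simp [smul_smul, hyx]
  refine ⟨φ ∘ₗ (LinearMap.id - h.smulRight e).codRestrict (LinearMap.ker π) hker +
    h.smulRight n, LinearMap.ext fun p ↦ ?_⟩
  have hp : h p ∈ Ideal.span {x} := by
    rw [← Submodule.Quotient.mk_eq_zero, ← Submodule.mkQ_apply, ← hπh]
    exact p.2
  obtain ⟨r, hr⟩ := Ideal.mem_span_singleton'.1 hp
  have key : (LinearMap.id - h.smulRight e).codRestrict (LinearMap.ker π) hker p =
      p - r • (⟨x • e, hxe⟩ : LinearMap.ker π) := by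
    ext
    change (p : P) - h p • e = p - r • x • e
    rw [← hr, mul_smul]
  simp only [LinearMap.comp_apply, LinearMap.add_apply, Submodule.subtype_apply, key, map_sub,
    map_smul, hn, LinearMap.smulRight_apply, ← hr, mul_smul, sub_add_cancel]

/-- If `y * x = 0` and every element of `N` killed by `y` is a multiple of `x`, then
`Ext¹_R(R/(x), N) = 0`. -/
theorem subsingleton_extModule_one_quotient_span_singleton {R N : Type u} [CommRing R]
    [AddCommGroup N] [Module R N] {x y : R} (hyx : y * x = 0)
    (hN : ∀ n : N, y • n = 0 → ∃ m, n = x • m) :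
    Subsingleton (extModule R (R ⧸ Ideal.span {x}) N 1) := by
  let P := projectiveResolution (ModuleCat.of R (R ⧸ Ideal.span {x}))
  rw [← ModuleCat.isZero_iff_subsingleton]
  refine Limits.IsZero.of_iso ?_ (P.isoExt 1 (ModuleCat.of R N))
  rw [← HomologicalComplex.exactAt_iff_isZero_homology,
    HomologicalComplex.exactAt_iff' _ 0 1 2 (by simp) (by simp), ShortComplex.moduleCat_exact_iff]
  intro (f : P.complex.X 1 ⟶ ModuleCat.of R N) (hf : P.complex.d 2 1 ≫ f = 0)
  let π : P.complex.X 0 →ₗ[R] R ⧸ Ideal.span {x} := (P.π.f 0).hom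
  have hπ : Function.Surjective π := (ModuleCat.epi_iff_surjective (P.π.f 0)).1 inferInstance
  have : Module.Projective R (P.complex.X 0) :=
    (IsProjective.iff_projective _).2 (P.projective 0)
  have h₀ : (ShortComplex.mk _ _ P.complex_d_comp_π_f_zero).Exact :=
    ShortComplex.exact_of_g_is_cokernel _ P.isColimitCokernelCofork
  have h₁ : LinearMap.range (P.complex.d 2 1).hom = LinearMap.ker (P.complex.d 1 0).hom :=
    (P.exact_succ 0).moduleCat_range_eq_ker
  have hr : LinearMap.range (P.complex.d 1 0).hom = LinearMap.ker π := h₀.moduleCat_range_eq_ker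
  have hle : LinearMap.ker (P.complex.d 1 0).hom ≤ LinearMap.ker f.hom := by
    rw [← h₁, LinearMap.range_le_ker_iff, ← ModuleCat.hom_comp, hf, ModuleCat.hom_zero]
  obtain ⟨g, hg⟩ := exists_comp_ker_subtype_eq hyx hN π hπ
    ((LinearMap.ker (P.complex.d 1 0).hom).liftQ f.hom hle ∘ₗ
      ((P.complex.d 1 0).hom.quotKerEquivRange.trans (LinearEquiv.ofEq _ _ hr)).symm)
  refine ⟨ModuleCat.ofHom g, ?_⟩
  change P.complex.d 1 0 ≫ ModuleCat.ofHom g = f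
  ext b
  have hb : (P.complex.d 1 0).hom b ∈ LinearMap.ker π := hr ▸ LinearMap.mem_range_self _ b
  have hs : ((P.complex.d 1 0).hom.quotKerEquivRange.trans (LinearEquiv.ofEq _ _ hr)).symm
      ⟨_, hb⟩ = Submodule.Quotient.mk b := by
    rw [LinearEquiv.symm_apply_eq]
    rfl
  have := LinearMap.congr_fun hg ⟨_, hb⟩
  rw [LinearMap.comp_apply, LinearMap.comp_apply, LinearEquiv.coe_coe, hs] at this
  exact this

theorem MvPowerSeries.X_dvd_of_dvd_X_mul {σ k : Type*} [CommSemiring k] {s t : σ} (hst : s ≠ t)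
    {f : MvPowerSeries σ k} (h : MvPowerSeries.X s ∣ MvPowerSeries.X t * f) :
    MvPowerSeries.X s ∣ f := by
  classical
  rw [MvPowerSeries.X_dvd_iff] at h ⊢
  intro m hm
  have := h (Finsupp.single t 1 + m) (by simp [hm, hst.symm])
  rwa [MvPowerSeries.X, MvPowerSeries.coeff_add_monomial_mul, one_mul] at this

/-- **Example 3.6.** For `R = k[[x,y]]/(xy)`, one has `Ext¹_R(R/(x), R/(x²)) = 0`. -/
theorem hw_ext_one_vanishes (k : Type u) [Field k] :
    Subsingleton (extModule (HWRing k) (HWM k) (HWN k) 1) := by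
  refine subsingleton_extModule_one_quotient_span_singleton
    (y := Ideal.Quotient.mk _ (MvPowerSeries.X 1)) ?_ fun n hn ↦ ?_
  · rw [HWx, ← map_mul, Ideal.Quotient.eq_zero_iff_mem, mul_comm]
    exact Ideal.mem_span_singleton_self _
  · obtain ⟨n, rfl⟩ := Ideal.Quotient.mk_surjective n
    obtain ⟨f, rfl⟩ := Ideal.Quotient.mk_surjective n
    obtain ⟨a, ha⟩ := Ideal.mem_span_singleton'.1 (Ideal.Quotient.eq_zero_iff_mem.1 hn)
    obtain ⟨a, rfl⟩ := Ideal.Quotient.mk_surjective a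
    simp only [smul_eq_mul] at ha
    rw [HWx, ← map_pow, ← map_mul, ← map_mul, Ideal.Quotient.eq,
      Ideal.mem_span_singleton] at ha
    have hf : (MvPowerSeries.X 0 : MvPowerSeries (Fin 2) k) ∣ f := by
      refine MvPowerSeries.X_dvd_of_dvd_X_mul (t := 1) (by decide) ?_
      refine (dvd_sub_right ?_).1 ((dvd_mul_right _ _).trans ha)
      exact (dvd_pow_self _ two_ne_zero).mul_left a
    obtain ⟨g, rfl⟩ := hf
    exact ⟨Ideal.Quotient.mk _ (Ideal.Quotient.mk _ g), by rw [map_mul, map_mul]; rfl⟩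
end
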